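/- Let (J,R,Q,G,F,S,N) be pH plant data of state dimension n and port dimension m, and (J_K,R_K,Q_K,G_K,F_K,S_K,N_K) be pH controller data of state dimension k and port dimension m. Define ℰ = diag(I_n, I_k, 0_{m}, 0_{m}), 𝒬 = diag(Q, Q_K, I_m, I_m), and M = [[(J−R)Q, 0, G−F, 0],[0, (J_K−R_K)Q_K, 0, G_K−F_K],[−(G+F)ᵀQ, 0, −(S−N), −I_m],[0, −(G_K+F_K)ᵀQ_K, I_m, −(S_K−N_K)]] ∈ ℝ^{(n+k+2m)×(n+k+2m)} (so that the closed-loop pencil is sℰ − M). Then: (i) ℰᵀ𝒬 is symmetric positive semidefinite; (ii) 𝒬 is symmetric positive definite; and (iii) M𝒬⁻¹ + 𝒬⁻¹Mᵀ is negative semidefinite; consequently, writing 𝒥 = (M𝒬⁻¹ − 𝒬⁻¹Mᵀ)/2 and ℛ = −(M𝒬⁻¹ + 𝒬⁻¹Mᵀ)/2, one has M = (𝒥 − ℛ)𝒬 with 𝒥 skew-symmetric and ℛ symmetric positive semidefinite, i.e., sℰ − M is a dissipative Hamiltonian pencil. -/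

import Mathlib

open Matrix

theorem Matrix.star_dotProduct_fromBlocks_diagonal_mulVec {p q : Type*} [Fintype p] [Fintype q]
    (A : Matrix p p ℝ) (D : Matrix q q ℝ) (x : p ⊕ q → ℝ) :
    star x ⬝ᵥ (fromBlocks A 0 0 D *ᵥ x) =
      star (x ∘ Sum.inl) ⬝ᵥ (A *ᵥ (x ∘ Sum.inl)) +
        star (x ∘ Sum.inr) ⬝ᵥ (D *ᵥ (x ∘ Sum.inr)) := by
  simp [fromBlocks_mulVec, dotProduct]

theorem Matrix.PosSemidef.fromBlocks_zero {p q : Type*} [Fintype p] [Fintype q]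
    {A : Matrix p p ℝ} {D : Matrix q q ℝ} (hA : A.PosSemidef) (hD : D.PosSemidef) :
    (fromBlocks A 0 0 D).PosSemidef := by
  refine .of_dotProduct_mulVec_nonneg
    (IsHermitian.fromBlocks hA.isHermitian (by simp) hD.isHermitian) fun x => ?_
  rw [star_dotProduct_fromBlocks_diagonal_mulVec]
  exact add_nonneg (hA.dotProduct_mulVec_nonneg _) (hD.dotProduct_mulVec_nonneg _)

theorem Matrix.PosDef.fromBlocks_zero {p q : Type*} [Fintype p] [Fintype q]
    {A : Matrix p p ℝ} {D : Matrix q q ℝ} (hA : A.PosDef) (hD : D.PosDef) :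
    (fromBlocks A 0 0 D).PosDef := by
  refine .of_dotProduct_mulVec_pos
    (IsHermitian.fromBlocks hA.isHermitian (by simp) hD.isHermitian) fun x hx => ?_
  rw [star_dotProduct_fromBlocks_diagonal_mulVec]
  by_cases hl : x ∘ Sum.inl = 0
  · have hr : x ∘ Sum.inr ≠ 0 := fun hr => hx <| by
      rw [← Sum.elim_comp_inl_inr x, hl, hr, Sum.elim_zero_zero]
    exact add_pos_of_nonneg_of_pos (hA.posSemidef.dotProduct_mulVec_nonneg _)
      (hD.dotProduct_mulVec_pos hr)
  · exact add_pos_of_pos_of_nonneg (hA.dotProduct_mulVec_pos hl)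
      (hD.posSemidef.dotProduct_mulVec_nonneg _)

/-- Interleaving two positive semidefinite block matrices gives a positive semidefinite matrix. -/
theorem Matrix.PosSemidef.fromBlocks_interleave {p q r s : Type*}
    [Fintype p] [Fintype q] [Fintype r] [Fintype s]
    {A : Matrix p p ℝ} {B : Matrix p r ℝ} {C : Matrix r p ℝ} {D : Matrix r r ℝ}
    {A' : Matrix q q ℝ} {B' : Matrix q s ℝ} {C' : Matrix s q ℝ} {D' : Matrix s s ℝ}
    (h : (fromBlocks A B C D).PosSemidef) (h' : (fromBlocks A' B' C' D').PosSemidef) :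
    (fromBlocks (fromBlocks A 0 0 A') (fromBlocks B 0 0 B')
      (fromBlocks C 0 0 C') (fromBlocks D 0 0 D')).PosSemidef := by
  convert! (h.fromBlocks_zero h').submatrix (Equiv.sumSumSumComm p q r s)
  ext ((i | i) | (i | i)) ((j | j) | (j | j)) <;> rfl

/-- With `ℰ = diag(I_n, I_k, 0, 0)`, `𝒬 = diag(Q, Q_K, I_m, I_m)` and `M`
the closed-loop pencil matrix, one has: (i) `ℰᵀ𝒬 ⪰ 0`; (ii) `𝒬 ≻ 0`;
(iii) `M𝒬⁻¹ + 𝒬⁻¹Mᵀ ⪯ 0`; consequently, with `𝒥 = (M𝒬⁻¹ − 𝒬⁻¹Mᵀ)/2` and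
`ℛ = −(M𝒬⁻¹ + 𝒬⁻¹Mᵀ)/2`, we get `M = (𝒥 − ℛ)𝒬` with `𝒥` skew-symmetric and `ℛ ⪰ 0`,
i.e. `sℰ − M` is a dissipative Hamiltonian pencil. -/
theorem closed_loop_pencil_is_dissipative_Hamiltonian
    (n k m : ℕ)
    (J R Q : Matrix (Fin n) (Fin n) ℝ) (G F : Matrix (Fin n) (Fin m) ℝ)
    (S N : Matrix (Fin m) (Fin m) ℝ)
    (JK RK QK : Matrix (Fin k) (Fin k) ℝ) (GK FK : Matrix (Fin k) (Fin m) ℝ)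
    (SK NK : Matrix (Fin m) (Fin m) ℝ)
    (hJ : Jᵀ = -J) (hN : Nᵀ = -N) (hQ : Q.PosDef)
    (hW : (Matrix.fromBlocks R F Fᵀ S).PosSemidef)
    (hJK : JKᵀ = -JK) (hNK : NKᵀ = -NK) (hQK : QK.PosDef)
    (hWK : (Matrix.fromBlocks RK FK FKᵀ SK).PosSemidef)
    (E Qc M : Matrix ((Fin n ⊕ Fin k) ⊕ (Fin m ⊕ Fin m))
                     ((Fin n ⊕ Fin k) ⊕ (Fin m ⊕ Fin m)) ℝ)
    (hE : E = Matrix.fromBlocks (Matrix.fromBlocks 1 0 0 1) 0 0 0)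
    (hQc : Qc = Matrix.fromBlocks (Matrix.fromBlocks Q 0 0 QK) 0 0
                                  (Matrix.fromBlocks 1 0 0 1))
    (hM : M = Matrix.fromBlocks
      (Matrix.fromBlocks ((J - R) * Q) 0 0 ((JK - RK) * QK))
      (Matrix.fromBlocks (G - F) 0 0 (GK - FK))
      (Matrix.fromBlocks (-((G + F)ᵀ * Q)) 0 0 (-((GK + FK)ᵀ * QK)))
      (Matrix.fromBlocks (-(S - N)) (-1) 1 (-(SK - NK))))
    (Jc Rc : Matrix ((Fin n ⊕ Fin k) ⊕ (Fin m ⊕ Fin m))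
                    ((Fin n ⊕ Fin k) ⊕ (Fin m ⊕ Fin m)) ℝ)
    (hJc : Jc = (2 : ℝ)⁻¹ • (M * Qc⁻¹ - Qc⁻¹ * Mᵀ))
    (hRc : Rc = -((2 : ℝ)⁻¹ • (M * Qc⁻¹ + Qc⁻¹ * Mᵀ))) :
    (Eᵀ * Qc).PosSemidef ∧ Qc.PosDef ∧
      (-(M * Qc⁻¹ + Qc⁻¹ * Mᵀ)).PosSemidef ∧
      M = (Jc - Rc) * Qc ∧ Jcᵀ = -Jc ∧ Rc.PosSemidef := by
  have hQc_pos : Qc.PosDef := by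
    rw [hQc, fromBlocks_one]
    exact (hQ.fromBlocks_zero hQK).fromBlocks_zero .one
  have hdet : IsUnit Qc.det := (isUnit_iff_isUnit_det Qc).1 hQc_pos.isUnit
  have hQc_symm : Qcᵀ = Qc := by simpa using hQc_pos.isHermitian.eq
  obtain ⟨hR, -, -, hS⟩ := isHermitian_fromBlocks_iff.1 hW.isHermitian
  obtain ⟨hRK, -, -, hSK⟩ := isHermitian_fromBlocks_iff.1 hWK.isHermitian
  rw [IsHermitian, conjTranspose_eq_transpose_of_trivial] at hR hS hRK hSK
  -- `K = M * Qc⁻¹`, written blockwise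
  obtain ⟨K, hK⟩ : ∃ K, K = fromBlocks
      (fromBlocks (J - R) 0 0 (JK - RK))
      (fromBlocks (G - F) 0 0 (GK - FK))
      (fromBlocks (-(G + F)ᵀ) 0 0 (-(GK + FK)ᵀ))
      (fromBlocks (-(S - N)) (-1) 1 (-(SK - NK))) := ⟨_, rfl⟩
  have hMK : M = K * Qc := by
    simp [hM, hK, hQc, fromBlocks_multiply, -neg_add_rev, -transpose_add]
  have hright : M * Qc⁻¹ = K := by rw [hMK, mul_nonsing_inv_cancel_right _ _ hdet]
  have hleft : Qc⁻¹ * Mᵀ = Kᵀ := by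
    rw [← hright, transpose_mul, transpose_nonsing_inv, hQc_symm]
  have hdiss : (-(K + Kᵀ)).PosSemidef := by
    have hKW : -(K + Kᵀ) = (2 : ℝ) • fromBlocks (fromBlocks R 0 0 RK) (fromBlocks F 0 0 FK)
        (fromBlocks Fᵀ 0 0 FKᵀ) (fromBlocks S 0 0 SK) := by
      simp only [hK, fromBlocks_transpose, fromBlocks_add, fromBlocks_neg,
        transpose_sub, transpose_add, transpose_neg, transpose_zero, transpose_one,
        transpose_transpose, hJ, hN, hJK, hNK, hR, hS, hRK, hSK, two_smul]
      congr 2 <;> abel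
    rw [hKW]
    exact (hW.fromBlocks_interleave hWK).smul zero_le_two
  rw [hright, hleft] at hJc hRc ⊢
  refine ⟨?_, hQc_pos, hdiss, ?_, ?_, ?_⟩
  · have hEQ : Eᵀ * Qc = fromBlocks (fromBlocks Q 0 0 QK) 0 0 0 := by
      simp [hE, hQc, fromBlocks_transpose, fromBlocks_multiply]
    rw [hEQ]
    exact (hQ.posSemidef.fromBlocks_zero hQK.posSemidef).fromBlocks_zero .zero
  · have hsplit : Jc - Rc = K := by
      rw [hJc, hRc]
      module
    rw [hsplit, hMK]
  · rw [hJc, transpose_smul, transpose_sub, transpose_transpose, ← smul_neg, neg_sub]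
  · rw [hRc, ← smul_neg]
    exact hdiss.smul (by norm_num)
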